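/- Let g = diag(ε₁, …, εₙ) with each ε_i = ±1 be a constant matrix, let β ∈ ℝⁿ, let γ ∈ Mₙ(ℝ) be constant symmetric, define J(q) = (βqᵀ + qβᵀ + γ) g, J^{ij}(q) = β^i q^j + β^j q^i + γ^{ij}, and σ(q) = det J(q). At any point q with σ(q) ≠ 0, setting σ_j = (1/σ)∂σ/∂q^j, one has J^{ij} ∂σ_j/∂q^i = −(2/σ)(n+1) βᵀ g (cof J(q)) β. -/

import Mathlib

noncomputable section
open Matrix

/-- Partial derivative `∂f/∂q^i` of a scalar function on `ℝⁿ`. -/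
def pd {n : ℕ} (f : (Fin n → ℝ) → ℝ) (i : Fin n) (q : Fin n → ℝ) : ℝ :=
  fderiv ℝ f q (Pi.single i 1)

theorem hasFDerivAt_matrix_det {E m : Type*} [NormedAddCommGroup E] [NormedSpace ℝ E]
    [Fintype m] [DecidableEq m] {M : E → Matrix m m ℝ} {M' : m → m → E →L[ℝ] ℝ} {x : E}
    (h : ∀ i j, HasFDerivAt (fun y => M y i j) (M' i j) x) :
    HasFDerivAt (fun y => (M y).det) (∑ i, ∑ j, (M x).adjugate j i • M' i j) x := by
  let D : ContinuousMultilinearMap ℝ (fun _ : m => m → ℝ) ℝ :=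
    { (detRowAlternating (n := m) (R := ℝ)).toMultilinearMap with
      cont := Continuous.matrix_det (A := fun y : m → m → ℝ => Matrix.of y) continuous_id }
  have hM : HasFDerivAt (fun y i j => M y i j)
      (ContinuousLinearMap.pi fun i => ContinuousLinearMap.pi fun j => M' i j) x :=
    hasFDerivAt_pi.2 fun i => hasFDerivAt_pi.2 fun j => h i j
  refine ((D.hasFDerivAt (fun i j => M x i j)).comp x hM).congr_fderiv ?_
  ext v
  have key (i : m) : ((M x).updateRow i fun j => M' i j v).det
      = ∑ j, (M x).adjugate j i * M' i j v := by
    rw [← cramer_transpose_apply, cramer_eq_adjugate_mulVec, ← adjugate_transpose]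
    rfl
  simp only [ContinuousLinearMap.comp_apply, ContinuousMultilinearMap.linearDeriv_apply,
    _root_.sum_apply, _root_.smul_apply, smul_eq_mul, ← key]
  rfl

theorem differentiableAt_adjugate_apply {E m : Type*} [NormedAddCommGroup E] [NormedSpace ℝ E]
    [Fintype m] [DecidableEq m] {M : E → Matrix m m ℝ} {x : E}
    (h : ∀ i j, DifferentiableAt ℝ (fun y => M y i j) x) (i j : m) :
    DifferentiableAt ℝ (fun y => (M y).adjugate i j) x := by
  simp only [adjugate_apply]
  refine (hasFDerivAt_matrix_det (M' := fun a b => fderiv ℝ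
    (fun y => (M y).updateRow j (Pi.single i 1) a b) x) fun a b => ?_).differentiableAt
  refine DifferentiableAt.hasFDerivAt ?_
  by_cases ha : a = j
  · subst ha
    simp
  · simpa [updateRow_ne ha] using h a b

theorem isSymm_vecMulVec_add_vecMulVec_add {n : ℕ} (β q : Fin n → ℝ)
    {γ : Matrix (Fin n) (Fin n) ℝ} (hγ : γ.IsSymm) :
    (vecMulVec β q + vecMulVec q β + γ).IsSymm := by
  ext i j
  simp [vecMulVec_apply, hγ.apply i j]
  ring

theorem hasFDerivAt_vecMulVec_add_apply {n : ℕ} (β : Fin n → ℝ) (γ : Matrix (Fin n) (Fin n) ℝ)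
    (q : Fin n → ℝ) (i j : Fin n) :
    HasFDerivAt (fun q' => (vecMulVec β q' + vecMulVec q' β + γ) i j)
      (β i • ContinuousLinearMap.proj j + β j • ContinuousLinearMap.proj i :
        (Fin n → ℝ) →L[ℝ] ℝ) q := by
  simp only [Matrix.add_apply, vecMulVec_apply]
  exact (((hasFDerivAt_apply j q).const_mul (β i)).add
    ((hasFDerivAt_apply i q).mul_const (β j))).add_const _

theorem pd_det_vecMulVec_add {n : ℕ} (β : Fin n → ℝ) {γ : Matrix (Fin n) (Fin n) ℝ}
    (hγ : γ.IsSymm) (q : Fin n → ℝ) (j : Fin n) :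
    pd (fun q' => (vecMulVec β q' + vecMulVec q' β + γ).det) j q
      = 2 * ((vecMulVec β q + vecMulVec q β + γ).adjugate *ᵥ β) j := by
  have hs := (isSymm_vecMulVec_add_vecMulVec_add β q hγ).adjugate
  rw [pd, (hasFDerivAt_matrix_det (hasFDerivAt_vecMulVec_add_apply β γ q)).fderiv]
  generalize (vecMulVec β q + vecMulVec q β + γ).adjugate = A at hs ⊢
  simp only [_root_.sum_apply, _root_.smul_apply, _root_.add_apply,
    ContinuousLinearMap.proj_apply, smul_eq_mul, Pi.single_apply, mul_add, mul_ite, mul_one,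
    mul_zero, Finset.sum_add_distrib, Finset.sum_ite_eq', Finset.sum_ite_irrel,
    Finset.sum_const_zero, Finset.mem_univ, if_true, mulVec, dotProduct, two_mul]
  simp only [hs.apply]

/-- For `g = diag(ε)` constant and `J(q) = (βqᵀ + qβᵀ + γ)g`
with `σ = det J`, at any point with `σ(q) ≠ 0` and with `σ_j = (1/σ)∂σ/∂q^j`,
one has `J^{ij} ∂σ_j/∂q^i = −(2/σ)(n+1) βᵀ g (cof J) β`. -/
theorem J_contract_deriv_log_det
    (n : ℕ) (ε : Fin n → ℝ) (hε : ∀ i, ε i = 1 ∨ ε i = -1)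
    (g : Matrix (Fin n) (Fin n) ℝ) (hg : g = Matrix.diagonal ε)
    (β : Fin n → ℝ) (γ : Matrix (Fin n) (Fin n) ℝ) (hγ : γ.IsSymm)
    (J : (Fin n → ℝ) → Matrix (Fin n) (Fin n) ℝ)
    (hJ : J = fun q => (vecMulVec β q + vecMulVec q β + γ) * g)
    (Jc : (Fin n → ℝ) → Matrix (Fin n) (Fin n) ℝ)
    (hJc : ∀ q i j, Jc q i j = β i * q j + β j * q i + γ i j)
    (σ : (Fin n → ℝ) → ℝ) (hσ : σ = fun q => (J q).det)
    (q : Fin n → ℝ) (hq : σ q ≠ 0) :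
    ∑ i, ∑ j, Jc q i j * pd (fun q' => (1 / σ q') * pd σ j q') i q
      = -(2 / σ q) * ((n : ℝ) + 1) * (β ⬝ᵥ ((g * (J q).adjugate) *ᵥ β)) := by
  subst hg hJ hσ
  set S : (Fin n → ℝ) → Matrix (Fin n) (Fin n) ℝ :=
    fun q => vecMulVec β q + vecMulVec q β + γ with hS
  have hc : (diagonal ε).det ≠ 0 := by
    rw [det_diagonal]
    refine Finset.prod_ne_zero_iff.2 fun i _ => ?_
    rcases hε i with h | h <;> simp [h]
  set c := (diagonal ε).det
  have hdet : ∀ q, (S q * diagonal ε).det = c * (S q).det := fun q => by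
    rw [det_mul, mul_comm]
  have hSd : ∀ q i j, HasFDerivAt (fun q' => S q' i j)
      (β i • ContinuousLinearMap.proj j + β j • ContinuousLinearMap.proj i :
        (Fin n → ℝ) →L[ℝ] ℝ) q := hasFDerivAt_vecMulVec_add_apply β γ
  have hd : ∀ q, DifferentiableAt ℝ (fun q' => (S q').det) q := fun q =>
    (hasFDerivAt_matrix_det (hSd q)).differentiableAt
  have hSq : (S q).det ≠ 0 := fun h => hq ((hdet q).trans (by rw [h, mul_zero]))
  have hF : ∀ j, (fun q' => (1 / (S q' * diagonal ε).det) *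
      pd (fun q => (S q * diagonal ε).det) j q')
      = fun q' => 2 * ((S q').det⁻¹ * ((S q').adjugate *ᵥ β) j) := fun j => by
    funext q'
    have hp : pd (fun q => (S q * diagonal ε).det) j q'
        = c * (2 * ((S q').adjugate *ᵥ β) j) := by
      rw [← pd_det_vecMulVec_add β hγ q' j]
      simp only [hdet, pd]
      rw [fderiv_const_mul (hd q')]
      rfl
    rw [hp, hdet, one_div, mul_inv]
    field_simp
  have hJcS : ∀ i j, Jc q i j = S q i j := fun i j => by
    rw [hJc]
    simp [hS, vecMulVec_apply]
    ring
  change ∑ i, ∑ j, Jc q i j * pd (fun q' => (1 / (S q' * diagonal ε).det) *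
      pd (fun q => (S q * diagonal ε).det) j q') i q
    = -(2 / (S q * diagonal ε).det) * ((n : ℝ) + 1) *
      (β ⬝ᵥ ((diagonal ε * (S q * diagonal ε).adjugate) *ᵥ β))
  simp only [hF, hJcS]
  set F : Fin n → (Fin n → ℝ) → ℝ :=
    fun j q' => 2 * ((S q').det⁻¹ * ((S q').adjugate *ᵥ β) j) with hFdef
  have hFd : ∀ j, DifferentiableAt ℝ (F j) q := fun j => by
    refine (((hd q).inv hSq).mul ?_).const_mul 2
    simp only [mulVec, dotProduct]
    exact DifferentiableAt.fun_sum fun k _ => (differentiableAt_adjugate_apply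
      (fun a b => (hSd q a b).differentiableAt) j k).mul_const _
  have hSF : ∀ i, (fun q' => ∑ j, S q' i j * F j q') =ᶠ[nhds q] fun _ => 2 * β i := fun i => by
    filter_upwards [(hd q).continuousAt.eventually_ne hSq] with q' hq'
    have h : (S q' *ᵥ ((S q').adjugate *ᵥ β)) i = (S q').det * β i := by
      rw [mulVec_mulVec, mul_adjugate, smul_mulVec, one_mulVec]
      rfl
    calc ∑ j, S q' i j * F j q'
        = 2 * (S q').det⁻¹ * (S q' *ᵥ ((S q').adjugate *ᵥ β)) i := by
          rw [mulVec, dotProduct, Finset.mul_sum]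
          exact Finset.sum_congr rfl fun j _ => by simp only [hFdef]; ring
      _ = 2 * β i := by rw [h]; field_simp
  change ∑ i, ∑ j, S q i j * pd (F j) i q = _
  have hrow : ∀ i, ∑ j, S q i j * pd (F j) i q = -(F i q * β i + ∑ j, F j q * β j) := fun i => by
    have h1 : HasFDerivAt (fun q' => ∑ j, S q' i j * F j q') _ q :=
      HasFDerivAt.fun_sum fun j _ => (hSd q i j).mul (hFd j).hasFDerivAt
    have h2 := congrArg (fun L => L (Pi.single i 1))
      (h1.unique ((hasFDerivAt_const (2 * β i) q).congr_of_eventuallyEq (hSF i)))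
    simp only [_root_.sum_apply, _root_.smul_apply, _root_.add_apply,
      ContinuousLinearMap.proj_apply, smul_eq_mul, Pi.single_apply, mul_add, mul_ite, mul_one,
      mul_zero, Finset.sum_add_distrib, Finset.sum_ite_eq', if_true,
      Finset.mem_univ, _root_.zero_apply] at h2
    exact eq_neg_of_add_eq_zero_left h2
  have hadj : diagonal ε * (S q * diagonal ε).adjugate = c • (S q).adjugate := by
    rw [adjugate_mul_distrib, ← Matrix.mul_assoc, mul_adjugate, smul_mul, Matrix.one_mul]
  have hβF : ∑ j, F j q * β j = 2 * (S q).det⁻¹ * (β ⬝ᵥ ((S q).adjugate *ᵥ β)) := by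
    rw [dotProduct, Finset.mul_sum]
    exact Finset.sum_congr rfl fun j _ => by simp only [hFdef]; ring
  simp only [hrow, hadj, hdet, Finset.sum_neg_distrib, Finset.sum_add_distrib, Finset.sum_const,
    Finset.card_univ, Fintype.card_fin, nsmul_eq_mul, hβF, smul_mulVec, dotProduct_smul,
    smul_eq_mul]
  field_simp
  ring
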